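/- Let (μ_t)_{t∈[0,T]} be a subprobability solution to (NLFPK). If μ₀ is a probability measure, then μ_t(ℝ^d) = 1 for every t ∈ [0,T]; in particular t ↦ μ_t is weakly continuous and (μ_t)_{t∈[0,T]} is a probability solution to (NLFPK). -/

import Mathlib

open MeasureTheory Topology Filter

noncomputable section

/-- Euclidean space `ℝ^d`. -/
abbrev Rd (d : ℕ) := Fin d → ℝ

/-- The space of subprobability measures on `ℝ^d`. -/
def SP (d : ℕ) : Type := {μ : Measure (Rd d) // μ Set.univ ≤ 1}

/-- The vague topology on `SP d`: the initial topology of the maps `μ ↦ ∫ g dμ` for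
`g : ℝ^d → ℝ` continuous with compact support. -/
instance (d : ℕ) : TopologicalSpace (SP d) :=
  ⨅ g : {g : Rd d → ℝ // Continuous g ∧ HasCompactSupport g},
    TopologicalSpace.induced (fun μ : SP d => ∫ x, g.1 x ∂μ.1) inferInstance

instance (d : ℕ) : MeasurableSpace (SP d) := borel (SP d)
instance (d : ℕ) : BorelSpace (SP d) := ⟨rfl⟩

/-- First-order partial derivative `∂_i f`. -/
def pd {n : ℕ} (f : (Fin n → ℝ) → ℝ) (i : Fin n) (x : Fin n → ℝ) : ℝ :=
  fderiv ℝ f x (Pi.single i 1)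

/-- Second-order partial derivative `∂²_{ij} f`. -/
def pd2 {n : ℕ} (f : (Fin n → ℝ) → ℝ) (i j : Fin n) (x : Fin n → ℝ) : ℝ :=
  fderiv ℝ (fun y => pd f j y) x (Pi.single i 1)

/-- Twice continuously differentiable with compact support. -/
def IsC2c {n : ℕ} (φ : (Fin n → ℝ) → ℝ) : Prop :=
  ContDiff ℝ 2 φ ∧ HasCompactSupport φ

/-- Twice continuously differentiable, bounded, with bounded first and second order
partial derivatives. -/
def IsC2b {n : ℕ} (f : (Fin n → ℝ) → ℝ) : Prop :=
  ContDiff ℝ 2 f ∧ ∃ M : ℝ, ∀ x, |f x| ≤ M ∧ (∀ i, |pd f i x| ≤ M) ∧ ∀ i j, |pd2 f i j x| ≤ M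

/-- Borel coefficients, with `a` symmetric and positive semidefinite (`S⁺_d`-valued). -/
def GoodCoeffs (d : ℕ) (a : ℝ → SP d → Rd d → Fin d → Fin d → ℝ)
    (b : ℝ → SP d → Rd d → Fin d → ℝ) : Prop :=
  (∀ i j, Measurable fun p : ℝ × SP d × Rd d => a p.1 p.2.1 p.2.2 i j) ∧
  (∀ i, Measurable fun p : ℝ × SP d × Rd d => b p.1 p.2.1 p.2.2 i) ∧
  (∀ t μ x i j, a t μ x i j = a t μ x j i) ∧
  (∀ t μ x (v : Fin d → ℝ), 0 ≤ ∑ i, ∑ j, v i * a t μ x i j * v j)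

/-- The Kolmogorov operator `L_{t,μ}φ = ∑ a_ij ∂²_ij φ + ∑ b_i ∂_i φ`. -/
def Lop {d : ℕ} (a : ℝ → SP d → Rd d → Fin d → Fin d → ℝ)
    (b : ℝ → SP d → Rd d → Fin d → ℝ) (t : ℝ) (μ : SP d) (φ : Rd d → ℝ) (x : Rd d) : ℝ :=
  (∑ i, ∑ j, a t μ x i j * pd2 φ i j x) + ∑ i, b t μ x i * pd φ i x

/-- Global integrability condition for (NLFPK). -/
def NLFPKIntegrable (d : ℕ) (T : ℝ) (a : ℝ → SP d → Rd d → Fin d → Fin d → ℝ)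
    (b : ℝ → SP d → Rd d → Fin d → ℝ) (μ : ℝ → SP d) : Prop :=
  ∀ i j, ∫⁻ t in Set.Ioc (0:ℝ) T,
      ∫⁻ x, ENNReal.ofReal (|a t (μ t) x i j| + |b t (μ t) x i|) ∂(μ t).1 < ⊤

/-- The weak form of the nonlinear FPK equation, tested against `φ` at time `t`. -/
def NLFPKEq (d : ℕ) (a : ℝ → SP d → Rd d → Fin d → Fin d → ℝ)
    (b : ℝ → SP d → Rd d → Fin d → ℝ) (μ : ℝ → SP d) (φ : Rd d → ℝ) (t : ℝ) : Prop :=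
  ∫ x, φ x ∂(μ t).1 - ∫ x, φ x ∂(μ 0).1 = ∫ s in (0:ℝ)..t, ∫ x, Lop a b s (μ s) φ x ∂(μ s).1

/-- Subprobability solution to (NLFPK): a vaguely continuous, globally integrable curve
in `SP` satisfying the weak equation for all test functions in `C²_c(ℝ^d)`. -/
def IsSubprobSolution (d : ℕ) (T : ℝ) (a : ℝ → SP d → Rd d → Fin d → Fin d → ℝ)
    (b : ℝ → SP d → Rd d → Fin d → ℝ) (μ : ℝ → SP d) : Prop :=
  ContinuousOn μ (Set.Icc 0 T) ∧ NLFPKIntegrable d T a b μ ∧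
  ∀ φ : Rd d → ℝ, IsC2c φ → ∀ t ∈ Set.Icc (0:ℝ) T, NLFPKEq d a b μ φ t

/-- Weak continuity (in duality with bounded continuous functions) of a curve in `SP`. -/
def WeaklyContinuousOn {d : ℕ} (μ : ℝ → SP d) (s : Set ℝ) : Prop :=
  ∀ f : Rd d → ℝ, Continuous f → (∃ M, ∀ x, |f x| ≤ M) →
    ContinuousOn (fun t => ∫ x, f x ∂(μ t).1) s

/-- Probability solution to (NLFPK): a weakly continuous solution consisting of
probability measures. -/
def IsProbSolution (d : ℕ) (T : ℝ) (a : ℝ → SP d → Rd d → Fin d → Fin d → ℝ)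
    (b : ℝ → SP d → Rd d → Fin d → ℝ) (μ : ℝ → SP d) : Prop :=
  IsSubprobSolution d T a b μ ∧ (∀ t ∈ Set.Icc (0:ℝ) T, (μ t).1 Set.univ = 1) ∧
  WeaklyContinuousOn μ (Set.Icc 0 T)

namespace SP

instance isFiniteMeasure {d : ℕ} (μ : SP d) : IsFiniteMeasure μ.1 :=
  ⟨μ.2.trans_lt ENNReal.one_lt_top⟩

theorem continuous_integral {d : ℕ} {g : Rd d → ℝ} (hg : Continuous g)
    (hgc : HasCompactSupport g) : Continuous fun μ : SP d => ∫ x, g x ∂μ.1 :=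
  continuous_iInf_dom (i := ⟨g, hg, hgc⟩) continuous_induced_dom

theorem measurable_apply_of_isCompact {d : ℕ} {K : Set (Rd d)} (hK : IsCompact K) :
    Measurable fun μ : SP d => μ.1 K := by
  have hpos (n : ℕ) : (0 : ℝ) < 1 / ((n : ℝ) + 1) := by positivity
  refine measurable_of_tendsto_metrizable
    (f := fun n μ => ∫⁻ x, (thickenedIndicator (hpos n) K x : ENNReal) ∂μ.1) (fun n => ?_) ?_
  · simp_rw [fun μ : SP d => lintegral_coe_eq_integral (μ := μ.1) _
      (integrable_thickenedIndicator K (hpos n))]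
    refine ((continuous_integral ?_ ?_).measurable).ennreal_ofReal
    · exact NNReal.continuous_coe.comp (thickenedIndicator (hpos n) K).continuous
    · refine HasCompactSupport.intro (hK.cthickening (r := 1 / ((n : ℝ) + 1))) fun x hx => ?_
      rw [thickenedIndicator_zero (hpos n) K
        fun h => hx (Metric.thickening_subset_cthickening _ _ h), NNReal.coe_zero]
  · rw [tendsto_pi_nhds]
    exact fun μ => tendsto_lintegral_thickenedIndicator_of_isClosed μ.1 hK.isClosed hpos
      tendsto_one_div_add_atTop_nhds_zero_nat

theorem measurable_apply_of_isClosed {d : ℕ} {F : Set (Rd d)} (hF : IsClosed F) :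
    Measurable fun μ : SP d => μ.1 F := by
  refine measurable_of_tendsto_metrizable
    (f := fun (n : ℕ) μ => μ.1 (F ∩ Metric.closedBall 0 n))
    (fun n => measurable_apply_of_isCompact ((isCompact_closedBall _ _).inter_left hF)) ?_
  rw [tendsto_pi_nhds]
  intro μ
  have hmono : Monotone fun n : ℕ => F ∩ Metric.closedBall (0 : Rd d) n := fun m n hmn =>
    Set.inter_subset_inter_right _ (Metric.closedBall_subset_closedBall (by exact_mod_cast hmn))
  have h := tendsto_measure_iUnion_atTop (μ := μ.1) hmono
  rwa [← Set.inter_iUnion, Metric.iUnion_closedBall_nat, Set.inter_univ] at h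

theorem measurable_val {d : ℕ} : Measurable fun μ : SP d => μ.1 :=
  Measurable.measure_of_isPiSystem
    (BorelSpace.measurable_eq.trans borel_eq_generateFrom_isClosed) isPiSystem_isClosed
    (fun _ hs => measurable_apply_of_isClosed hs) (measurable_apply_of_isClosed isClosed_univ)

/-- Parametrized integrals along an a.e. measurable curve in `SP d` are a.e. measurable. -/
theorem aemeasurable_lintegral {d : ℕ} {ν : Measure ℝ} {μ : ℝ → SP d} (hμ : AEMeasurable μ ν)
    {g : ℝ × SP d × Rd d → ENNReal} (hg : Measurable g) :
    AEMeasurable (fun t => ∫⁻ x, g (t, μ t, x) ∂(μ t).1) ν := by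
  let κ : ProbabilityTheory.Kernel (ℝ × SP d) (Rd d) :=
    ⟨fun p => p.2.1, measurable_val.comp measurable_snd⟩
  have : ProbabilityTheory.IsFiniteKernel κ := ⟨1, ENNReal.one_lt_top, fun p => p.2.2⟩
  have hG : Measurable fun p : ℝ × SP d => ∫⁻ x, g (p.1, p.2, x) ∂κ p :=
    Measurable.lintegral_kernel_prod_right' (κ := κ) (f := fun q => g (q.1.1, q.1.2, q.2))
      (hg.comp (by fun_prop))
  exact hG.comp_aemeasurable (aemeasurable_id.prodMk hμ)

end SP

theorem pd_comp_smul {n : ℕ} {f : (Fin n → ℝ) → ℝ} (c : ℝ) (i : Fin n) (x : Fin n → ℝ) :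
    pd (fun y => f (c • y)) i x = c * pd f i (c • x) := by
  simp only [pd]
  rw [fderiv_comp_smul]
  simp

theorem pd2_comp_smul {n : ℕ} {f : (Fin n → ℝ) → ℝ} (hf : ContDiff ℝ 2 f) (c : ℝ)
    (i j : Fin n) (x : Fin n → ℝ) :
    pd2 (fun y => f (c • y)) i j x = c ^ 2 * pd2 f i j (c • x) := by
  have hd : Differentiable ℝ fun y => pd f j y :=
    ((hf.fderiv_right (m := 1) le_rfl).clm_apply contDiff_const).differentiable one_ne_zero
  simp only [pd2, pd_comp_smul]
  have hdc : DifferentiableAt ℝ (fun y => pd f j (c • y)) x :=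
    (hd _).fun_comp' x (differentiableAt_id.const_smul c)
  rw [fderiv_const_mul hdc, fderiv_comp_smul (f := fun y => pd f j y)]
  simp [sq, mul_assoc]

theorem IsC2c.isC2b {n : ℕ} {f : (Fin n → ℝ) → ℝ} (hf : IsC2c f) : IsC2b f := by
  have hpd (i : Fin n) : ContDiff ℝ 1 (pd f i) :=
    (hf.1.fderiv_right (m := 1) le_rfl).clm_apply contDiff_const
  have hpdc (i : Fin n) : HasCompactSupport (pd f i) := hf.2.fderiv_apply ℝ _
  have hpd2 (i j : Fin n) : Continuous (pd2 f i j) :=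
    ((hpd j).continuous_fderiv one_ne_zero).clm_apply continuous_const
  have hpd2c (i j : Fin n) : HasCompactSupport (pd2 f i j) := (hpdc j).fderiv_apply ℝ _
  obtain ⟨A, hA⟩ := hf.1.continuous.bounded_above_of_compact_support hf.2
  choose B hB using fun i => (hpd i).continuous.bounded_above_of_compact_support (hpdc i)
  choose C hC using fun i j => (hpd2 i j).bounded_above_of_compact_support (hpd2c i j)
  have hB0 (i : Fin n) : 0 ≤ B i := (norm_nonneg _).trans (hB i 0)
  have hC0 (i j : Fin n) : 0 ≤ C i j := (norm_nonneg _).trans (hC i j 0)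
  have hA0 : 0 ≤ A := (norm_nonneg _).trans (hA 0)
  have hBs : 0 ≤ ∑ i, B i := Finset.sum_nonneg fun i _ => hB0 i
  have hCs : 0 ≤ ∑ i, ∑ j, C i j :=
    Finset.sum_nonneg fun i _ => Finset.sum_nonneg fun j _ => hC0 i j
  refine ⟨hf.1, A + ∑ i, B i + ∑ i, ∑ j, C i j, fun x => ⟨?_, fun i => ?_, fun i j => ?_⟩⟩
  · exact (hA x).trans (by linarith)
  · have := Finset.single_le_sum (fun i _ => hB0 i) (Finset.mem_univ i)
    exact (hB i x).trans (by linarith)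
  · have h1 := Finset.single_le_sum (fun j _ => hC0 i j) (Finset.mem_univ j)
    have h2 := Finset.single_le_sum (f := fun i => ∑ j, C i j)
      (fun i _ => Finset.sum_nonneg fun j _ => hC0 i j) (Finset.mem_univ i)
    exact (hC i j x).trans (by linarith)

theorem abs_Lop_comp_smul_le {d : ℕ} (a : ℝ → SP d → Rd d → Fin d → Fin d → ℝ)
    (b : ℝ → SP d → Rd d → Fin d → ℝ) (t : ℝ) (μ : SP d) {φ : Rd d → ℝ} (hφ : ContDiff ℝ 2 φ)
    {M : ℝ} (hM1 : ∀ x i, |pd φ i x| ≤ M) (hM2 : ∀ x i j, |pd2 φ i j x| ≤ M)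
    {c : ℝ} (hc0 : 0 ≤ c) (hc1 : c ≤ 1) (x : Rd d) :
    |Lop a b t μ (fun y => φ (c • y)) x| ≤
      c * M * ∑ i, ∑ j, (|a t μ x i j| + |b t μ x i|) := by
  simp only [Lop, pd_comp_smul, pd2_comp_smul hφ, Finset.sum_add_distrib, mul_add]
  refine (abs_add_le _ _).trans (add_le_add ?_ ?_)
  · rw [Finset.mul_sum]
    refine (Finset.abs_sum_le_sum_abs _ _).trans (Finset.sum_le_sum fun i _ => ?_)
    rw [Finset.mul_sum]
    refine (Finset.abs_sum_le_sum_abs _ _).trans (Finset.sum_le_sum fun j _ => ?_)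
    rw [abs_mul, abs_mul, abs_of_nonneg (sq_nonneg c), mul_comm]
    have hM0 : 0 ≤ M := (abs_nonneg _).trans (hM1 x i)
    gcongr
    · nlinarith
    · exact hM2 _ i j
  · rw [Finset.mul_sum]
    refine (Finset.abs_sum_le_sum_abs _ _).trans (Finset.sum_le_sum fun i _ => ?_)
    have hM0 : 0 ≤ M := (abs_nonneg _).trans (hM1 x i)
    rw [abs_mul, abs_mul, abs_of_nonneg hc0, mul_comm]
    gcongr
    · exact hM1 _ i
    · exact Finset.single_le_sum (f := fun _ : Fin d => |b t μ x i|)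
        (fun _ _ => abs_nonneg _) (Finset.mem_univ i)

/-- Testing a solution against a dilated test function: the increments vanish linearly in the
dilation parameter, uniformly in time. -/
theorem IsSubprobSolution.exists_abs_integral_sub_le {d : ℕ} {T : ℝ}
    {a : ℝ → SP d → Rd d → Fin d → Fin d → ℝ} {b : ℝ → SP d → Rd d → Fin d → ℝ}
    (hab : GoodCoeffs d a b) {μ : ℝ → SP d} (hμ : IsSubprobSolution d T a b μ)
    {φ : Rd d → ℝ} (hφ : IsC2c φ) :
    ∃ K : ℝ, ∀ c : ℝ, 0 < c → c ≤ 1 → ∀ t ∈ Set.Icc (0 : ℝ) T,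
      |∫ x, φ (c • x) ∂(μ t).1 - ∫ x, φ (c • x) ∂(μ 0).1| ≤ c * K := by
  obtain ⟨hcont, hint, heq⟩ := hμ
  obtain ⟨ha, hb, -, -⟩ := hab
  obtain ⟨-, M, hM⟩ := hφ.isC2b
  have hM0 : 0 ≤ M := (abs_nonneg _).trans (hM 0).1
  have hae : AEMeasurable μ (volume.restrict (Set.Ioc 0 T)) :=
    (hcont.mono Set.Ioc_subset_Icc_self).aemeasurable measurableSet_Ioc
  let g (i j : Fin d) (p : ℝ × SP d × Rd d) : ENNReal :=
    ENNReal.ofReal (|a p.1 p.2.1 p.2.2 i j| + |b p.1 p.2.1 p.2.2 i|)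
  have hg (i j : Fin d) : Measurable (g i j) := by
    have h1 := (ha i j).norm
    have h2 := (hb i).norm
    exact (h1.add h2).ennreal_ofReal
  let H : ENNReal := ∫⁻ s in Set.Ioc (0 : ℝ) T, ∫⁻ x, ∑ i, ∑ j, g i j (s, μ s, x) ∂(μ s).1
  have hgx (s : ℝ) (i j : Fin d) : Measurable fun x => g i j (s, μ s, x) :=
    (hg i j).comp (by fun_prop)
  have hH : H ≠ ⊤ := by
    have hsum (s : ℝ) : ∫⁻ x, ∑ i, ∑ j, g i j (s, μ s, x) ∂(μ s).1
        = ∑ i, ∑ j, ∫⁻ x, g i j (s, μ s, x) ∂(μ s).1 := by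
      rw [lintegral_finsetSum _ fun i _ => Finset.measurable_sum _ fun j _ => hgx s i j]
      exact Finset.sum_congr rfl fun i _ => lintegral_finsetSum _ fun j _ => hgx s i j
    have haem (i j : Fin d) := SP.aemeasurable_lintegral hae (hg i j)
    simp only [H, hsum]
    rw [lintegral_finsetSum' _ fun i _ => Finset.aemeasurable_fun_sum _ fun j _ => haem i j]
    refine (ENNReal.sum_lt_top.2 fun i _ => ?_).ne
    rw [lintegral_finsetSum' _ fun j _ => haem i j]
    exact ENNReal.sum_lt_top.2 fun j _ => hint i j
  refine ⟨M * H.toReal, fun c hc0 hc1 t ht => ?_⟩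
  have hφc : IsC2c fun x => φ (c • x) :=
    ⟨hφ.1.comp (contDiff_const_smul c), hφ.2.comp_smul hc0.ne'⟩
  have hcM : 0 ≤ c * M := by positivity
  rw [heq _ hφc t ht, intervalIntegral.integral_of_le ht.1, ← Real.norm_eq_abs,
    ← toReal_enorm, ← mul_assoc, ← ENNReal.toReal_ofReal hcM, ← ENNReal.toReal_mul]
  refine ENNReal.toReal_mono (ENNReal.mul_ne_top ENNReal.ofReal_ne_top hH) ?_
  calc ‖∫ s in Set.Ioc 0 t, ∫ x, Lop a b s (μ s) (fun x => φ (c • x)) x ∂(μ s).1‖ₑ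
      ≤ ∫⁻ s in Set.Ioc 0 t, ∫⁻ x, ‖Lop a b s (μ s) (fun x => φ (c • x)) x‖ₑ ∂(μ s).1 :=
        (enorm_integral_le_lintegral_enorm _).trans
          (lintegral_mono fun s => enorm_integral_le_lintegral_enorm _)
    _ ≤ ∫⁻ s in Set.Ioc 0 T, ∫⁻ x, ‖Lop a b s (μ s) (fun x => φ (c • x)) x‖ₑ ∂(μ s).1 :=
        lintegral_mono_set (Set.Ioc_subset_Ioc_right ht.2)
    _ ≤ ∫⁻ s in Set.Ioc 0 T, ENNReal.ofReal (c * M) *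
          ∫⁻ x, ∑ i, ∑ j, g i j (s, μ s, x) ∂(μ s).1 := by
        refine lintegral_mono fun s => ?_
        rw [← lintegral_const_mul' _ _ ENNReal.ofReal_ne_top]
        refine lintegral_mono fun x => ?_
        rw [← ofReal_norm, Real.norm_eq_abs]
        refine (ENNReal.ofReal_le_ofReal (abs_Lop_comp_smul_le a b s (μ s) hφ.1
          (fun x => (hM x).2.1) (fun x => (hM x).2.2) hc0.le hc1 x)).trans_eq ?_
        rw [ENNReal.ofReal_mul hcM,
          ENNReal.ofReal_sum_of_nonneg fun i _ => Finset.sum_nonneg fun j _ => by positivity]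
        congr 1
        refine Finset.sum_congr rfl fun i _ => ?_
        exact ENNReal.ofReal_sum_of_nonneg fun j _ => by positivity
    _ = ENNReal.ofReal (c * M) * H := lintegral_const_mul' _ _ ENNReal.ofReal_ne_top

theorem exists_cutoff (d : ℕ) : ∃ φ : Rd d → ℝ, IsC2c φ ∧ φ 0 = 1 ∧ ∀ x, 0 ≤ φ x ∧ φ x ≤ 1 := by
  let f : ContDiffBump (0 : Rd d) := ⟨1, 2, one_pos, one_lt_two⟩
  exact ⟨f, ⟨f.contDiff, f.hasCompactSupport⟩,
    f.one_of_mem_closedBall (Metric.mem_closedBall_self zero_le_one),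
    fun x => ⟨f.nonneg, f.le_one⟩⟩

/-- Integrals of dilations of `φ` converge to `φ 0` times the total mass. -/
theorem tendsto_integral_comp_smul {d : ℕ} {φ : Rd d → ℝ} (hφ : Continuous φ) {M : ℝ}
    (hM : ∀ x, |φ x| ≤ M) {c : ℕ → ℝ} (hc : Tendsto c atTop (𝓝 0)) (ν : Measure (Rd d))
    [IsFiniteMeasure ν] :
    Tendsto (fun n => ∫ x, φ (c n • x) ∂ν) atTop (𝓝 (ν.real Set.univ * φ 0)) := by
  have h : Tendsto (fun n => ∫ x, φ (c n • x) ∂ν) atTop (𝓝 (∫ _, φ 0 ∂ν)) := by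
    refine tendsto_integral_of_dominated_convergence (fun _ => M)
      (fun n => (hφ.comp (continuous_const_smul _)).aestronglyMeasurable) (integrable_const M)
      (fun n => ae_of_all _ fun x => hM _) (ae_of_all _ fun x => ?_)
    have h0 : Tendsto (fun n => c n • x) atTop (𝓝 0) := by simpa using hc.smul_const x
    exact (hφ.tendsto 0).comp h0
  simpa using h

/-- Remark 2.2(i): a subprobability solution to (NLFPK) starting at a
probability measure has full mass for all times, hence is a probability solution. -/
theorem subprobSolution_mass_conservation (d : ℕ) (T : ℝ) (hT : 0 < T)
    (a : ℝ → SP d → Rd d → Fin d → Fin d → ℝ) (b : ℝ → SP d → Rd d → Fin d → ℝ)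
    (hab : GoodCoeffs d a b) (μ : ℝ → SP d)
    (hμ : IsSubprobSolution d T a b μ) (h0 : (μ 0).1 Set.univ = 1) :
    (∀ t ∈ Set.Icc (0:ℝ) T, (μ t).1 Set.univ = 1) ∧ IsProbSolution d T a b μ := by
  obtain ⟨φ, hφ, hφ0, hφ01⟩ := exists_cutoff d
  have hφabs (x : Rd d) : |φ x| ≤ 1 := by rw [abs_of_nonneg (hφ01 x).1]; exact (hφ01 x).2
  obtain ⟨K, hK⟩ := hμ.exists_abs_integral_sub_le hab hφ
  let c (n : ℕ) : ℝ := 1 / ((n : ℝ) + 1)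
  have hc0 (n : ℕ) : 0 < c n := by positivity
  have hc1 (n : ℕ) : c n ≤ 1 := by
    rw [div_le_one (by positivity)]
    linarith [(Nat.cast_nonneg n : (0 : ℝ) ≤ n)]
  have hc : Tendsto c atTop (𝓝 0) := tendsto_one_div_add_atTop_nhds_zero_nat
  have hlim (t : ℝ) :
      Tendsto (fun n => ∫ x, φ (c n • x) ∂(μ t).1) atTop (𝓝 ((μ t).1.real Set.univ)) := by
    simpa [hφ0] using tendsto_integral_comp_smul hφ.1.continuous hφabs hc (μ t).1
  have hr0 : (μ 0).1.real Set.univ = 1 := by simp [Measure.real, h0]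
  have hreal (t : ℝ) (ht : t ∈ Set.Icc 0 T) : (μ t).1.real Set.univ = 1 := by
    have h1 := ((hlim t).sub (hlim 0)).abs
    have h2 : Tendsto (fun n => c n * K) atTop (𝓝 0) := by simpa using hc.mul_const K
    have h3 := le_of_tendsto_of_tendsto' h1 h2 fun n => hK _ (hc0 n) (hc1 n) t ht
    linarith [abs_nonpos_iff.1 h3]
  have hmass (t : ℝ) (ht : t ∈ Set.Icc 0 T) : (μ t).1 Set.univ = 1 := by
    rw [← ENNReal.ofReal_toReal (measure_ne_top (μ t).1 Set.univ), ← Measure.real, hreal t ht,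
      ENNReal.ofReal_one]
  refine ⟨hmass, hμ, hmass, ?_⟩
  rintro f hf ⟨M, hM⟩
  have hM0 : 0 ≤ M := (abs_nonneg _).trans (hM 0)
  have hφn (n : ℕ) : Continuous fun x => φ (c n • x) :=
    hφ.1.continuous.comp (continuous_const_smul _)
  refine TendstoUniformlyOn.continuousOn (F := fun n t => ∫ x, f x * φ (c n • x) ∂(μ t).1)
    (p := atTop) ?_ (Frequently.of_forall fun n => ?_)
  · have hbound (n : ℕ) (t : ℝ) (ht : t ∈ Set.Icc 0 T) :
        dist (∫ x, f x ∂(μ t).1) (∫ x, f x * φ (c n • x) ∂(μ t).1) ≤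
          M * (1 - ∫ x, φ (c n • x) ∂(μ 0).1 + c n * K) := by
      have hfi : Integrable f (μ t).1 :=
        .of_bound hf.aestronglyMeasurable M (ae_of_all _ hM)
      have hφi : Integrable (fun x => φ (c n • x)) (μ t).1 :=
        .of_bound (hφn n).aestronglyMeasurable 1 (ae_of_all _ fun x => hφabs _)
      have hfφi : Integrable (fun x => f x * φ (c n • x)) (μ t).1 :=
        hφi.bdd_mul hf.aestronglyMeasurable (ae_of_all _ hM)
      rw [dist_eq_norm, ← integral_sub hfi hfφi]
      have hle : ‖∫ x, (f x - f x * φ (c n • x)) ∂(μ t).1‖ ≤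
          ∫ x, M * (1 - φ (c n • x)) ∂(μ t).1 := by
        refine norm_integral_le_of_norm_le (((integrable_const 1).sub hφi).const_mul M)
          (ae_of_all _ fun x => ?_)
        rw [← mul_one_sub, norm_mul, Real.norm_eq_abs, Real.norm_eq_abs,
          abs_of_nonneg (sub_nonneg.2 (hφ01 _).2)]
        exact mul_le_mul_of_nonneg_right (hM x) (sub_nonneg.2 (hφ01 _).2)
      refine hle.trans ?_
      rw [integral_const_mul, integral_sub (integrable_const 1) hφi, integral_const, hreal t ht,
        one_smul]
      have := (abs_le.1 (hK _ (hc0 n) (hc1 n) t ht)).1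
      exact mul_le_mul_of_nonneg_left (by linarith) hM0
    have hb0 : Tendsto (fun n => M * (1 - ∫ x, φ (c n • x) ∂(μ 0).1 + c n * K)) atTop (𝓝 0) := by
      have h := (((tendsto_const_nhds (x := (1 : ℝ))).sub (hlim 0)).add
        (hc.mul_const K)).const_mul M
      simpa [hr0] using h
    rw [Metric.tendstoUniformlyOn_iff]
    intro ε hε
    filter_upwards [hb0.eventually (gt_mem_nhds hε)] with n hn t ht
    exact (hbound n t ht).trans_lt hn
  · refine (SP.continuous_integral (hf.mul (hφn n)) ?_).comp_continuousOn hμ.1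
    exact (hφ.2.comp_smul (hc0 n).ne').mul_left
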